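/- arXiv:1708.09181 — 2 statements merged into one kernel-verified Lean document; each statement's English description precedes it below -/
import Mathlib

section
/- (Lemma: ℤ-indexed product expansion, u = 0 case.) Let n₁, n₂ ∈ ℤ be nonzero, a₁, a₂ ∈ ℝ, and z, τ ∈ ℂ with Im(n₁τ) > 0 and Im(n₂τ) > 0. Then θ_{n₁}[a₁/n₁](z,τ) · θ_{n₂}[a₂/n₂](z,τ) = Σ_{α∈ℤ} exp( πiτ (n₂a₁ − n₁(a₂ − n₂α))² / (n₁n₂(n₁+n₂)) ) · θ_{n₁+n₂}[(a₁ + a₂ − n₂α)/(n₁+n₂)](z,τ). -/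
lemma summable_theta_term (a : ℝ) (b z : ℂ) {τ : ℂ} (hτ : 0 < τ.im) :
    Summable fun m : ℤ => Complex.exp (Real.pi * Complex.I * ((m : ℂ) + (a : ℂ)) ^ 2 * τ +
      2 * Real.pi * Complex.I * ((m : ℂ) + (a : ℂ)) * (z + b)) := by
  refine (((summable_jacobiTheta₂_term_iff (z + b + a * τ) τ).mpr hτ).mul_left
    (Complex.exp (Real.pi * Complex.I * a ^ 2 * τ + 2 * Real.pi * Complex.I * a * (z + b)))).congr fun m => ?_
  rw [jacobiTheta₂_term, ← Complex.exp_add]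
  ring_nf

/-- The unimodular change of summation indices `(α, m) ↦ (m, m - α)` of `ℤ × ℤ`. -/
def intProdShearEquiv : ℤ × ℤ ≃ ℤ × ℤ where
  toFun p := (p.2, p.2 - p.1)
  invFun q := (q.1 - q.2, q.1)
  left_inv p := by simp
  right_inv q := by simp


/-- The theta function with characteristics
`θ[a;b](z,τ) := Σ_{m∈ℤ} exp(πi(m+a)²τ + 2πi(m+a)(z+b))`. -/
noncomputable def theta (a : ℝ) (b z τ : ℂ) : ℂ :=
  ∑' m : ℤ, Complex.exp (Real.pi * Complex.I * ((m : ℂ) + (a : ℂ)) ^ 2 * τ +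
    2 * Real.pi * Complex.I * ((m : ℂ) + (a : ℂ)) * (z + b))

/-- `θ_n[p](z,τ) := θ[p;0](nz, nτ)`. -/
noncomputable def thetaN (n : ℤ) (p : ℝ) (z τ : ℂ) : ℂ :=
  theta p 0 ((n : ℂ) * z) ((n : ℂ) * τ)

/-- ℤ-indexed product expansion (`u = 0` case):
`θ_{n₁}[a₁/n₁](z,τ) · θ_{n₂}[a₂/n₂](z,τ)
  = Σ_{α∈ℤ} exp(πiτ(n₂a₁−n₁(a₂−n₂α))²/(n₁n₂(n₁+n₂)))
      · θ_{n₁+n₂}[(a₁+a₂−n₂α)/(n₁+n₂)](z,τ)`. -/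
theorem thetaN_product_int_expansion (n₁ n₂ : ℤ) (h₁ : n₁ ≠ 0) (h₂ : n₂ ≠ 0)
    (a₁ a₂ : ℝ) (z τ : ℂ)
    (hτ₁ : 0 < ((n₁ : ℂ) * τ).im) (hτ₂ : 0 < ((n₂ : ℂ) * τ).im) :
    thetaN n₁ (a₁ / (n₁ : ℝ)) z τ * thetaN n₂ (a₂ / (n₂ : ℝ)) z τ =
      ∑' α : ℤ,
        Complex.exp ((Real.pi : ℂ) * Complex.I * τ *
            ((((n₂ : ℝ) * a₁ - (n₁ : ℝ) * (a₂ - (n₂ : ℝ) * (α : ℝ))) ^ 2 /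
              ((n₁ : ℝ) * (n₂ : ℝ) * ((n₁ : ℝ) + (n₂ : ℝ))) : ℝ) : ℂ)) *
        thetaN (n₁ + n₂) ((a₁ + (a₂ - (n₂ : ℝ) * (α : ℝ))) / ((n₁ : ℝ) + (n₂ : ℝ))) z τ := by
  have hn : (n₁ + n₂ : ℂ) ≠ 0 := by
    intro h
    have hpos : 0 < (((n₁ : ℂ) + n₂) * τ).im := by
      rw [add_mul, Complex.add_im]
      exact add_pos hτ₁ hτ₂
    simp [h] at hpos
  have hn₁ : (n₁ : ℂ) ≠ 0 := Int.cast_ne_zero.mpr h₁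
  have hn₂ : (n₂ : ℂ) ≠ 0 := Int.cast_ne_zero.mpr h₂
  have hs₁ := (summable_theta_term (a₁ / (n₁ : ℝ)) 0 (n₁ * z) hτ₁).norm
  have hs₂ := (summable_theta_term (a₂ / (n₂ : ℝ)) 0 (n₂ * z) hτ₂).norm
  have hs := summable_mul_of_summable_norm hs₁ hs₂
  simp only [thetaN, theta]
  rw [tsum_mul_tsum_of_summable_norm hs₁ hs₂, ← intProdShearEquiv.tsum_eq]
  refine (intProdShearEquiv.summable_iff.mpr hs).tsum_prod.trans ?_
  refine tsum_congr fun α => ?_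
  rw [← tsum_mul_left]
  refine tsum_congr fun m => ?_
  simp only [Function.comp_apply, intProdShearEquiv, Equiv.coe_fn_mk, ← Complex.exp_add]
  congr 1
  push_cast
  field_simp
  ring
end

section
/- (d-fold product formula for theta functions.) Let d ≥ 2, let n₀₁, …, n_{d−1,d} ∈ ℤ be nonzero, let a₀₁, …, a_{d−1,d} ∈ ℝ, and let z, τ ∈ ℂ with Im(n_{i−1,i}τ) > 0 for every i = 1, …, d. Then θ_{n₀₁}[a₀₁/n₀₁](z,τ) · θ_{n₁₂}[a₁₂/n₁₂](z,τ) ⋯ θ_{n_{d−1,d}}[a_{d−1,d}/n_{d−1,d}](z,τ) = Σ_{(α₁₂, …, α_{d−1,d}) ∈ ℤ^{d−1}} exp( 2πiτ · S_d(ã₀₁/n₀₁, …, ã_{d−1,d}/n_{d−1,d}) ) · θ_{n_{0,d}}[(ã₀₁ + ⋯ + ã_{d−1,d})/n_{0,d}](z,τ), where ã₀₁ := a₀₁ and ã_{i−1,i} := a_{i−1,i} − n_{i−1,i} α_{i−1,i} for i = 2, …, d, and n_{0,d} := n₀₁ + ⋯ + n_{d−1,d}. -/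
/-- The quadratic form `S_d`: given integers `n 0, …, n (d-1)` (representing
`n_{0,1}, …, n_{d−1,d}`) and reals `p 0, …, p (d-1)`, with
`n_{0,d} = Σ n i` and `p_{0,d} = (Σ nᵢpᵢ)/n_{0,d}`,
`S_d(p) = (1/2)(Σ nᵢpᵢ(pᵢ−1) − n_{0,d} p_{0,d}(p_{0,d}−1))`. -/
noncomputable def Sform (d : ℕ) (n : ℕ → ℤ) (p : ℕ → ℝ) : ℝ :=
  (1 / 2) * ((∑ i ∈ Finset.range d, (n i : ℝ) * p i * (p i - 1)) -
    (∑ i ∈ Finset.range d, (n i : ℝ)) *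
      ((∑ i ∈ Finset.range d, (n i : ℝ) * p i) / (∑ i ∈ Finset.range d, (n i : ℝ))) *
      ((∑ i ∈ Finset.range d, (n i : ℝ) * p i) / (∑ i ∈ Finset.range d, (n i : ℝ)) - 1))

/-- Given the shifts `(α₁₂, …, α_{d−1,d}) ∈ ℤ^{d−1}` (indexed here by `Fin (d-1)`,
where `α j` represents `α_{j+1,j+2}`), the shifted characteristics
`ã₀₁ := a₀₁` and `ã_{i−1,i} := a_{i−1,i} − n_{i−1,i} α_{i−1,i}` for `i = 2, …, d`.
Here `n i`, `a i` (for `0 ≤ i ≤ d−1`) represent `n_{i,i+1}`, `a_{i,i+1}`. -/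
noncomputable def shiftedChar (d : ℕ) (n : ℕ → ℤ) (a : ℕ → ℝ) (α : Fin (d - 1) → ℤ)
    (i : ℕ) : ℝ :=
  if h : 1 ≤ i ∧ i < d then a i - (n i : ℝ) * ((α ⟨i - 1, by omega⟩ : ℤ) : ℝ) else a i

/-- The series defining `theta` converges absolutely. -/
theorem summable_norm_theta_term (a : ℝ) (b z τ : ℂ) (hτ : 0 < τ.im) :
    Summable fun m : ℤ => ‖Complex.exp (Real.pi * Complex.I * ((m : ℂ) + (a : ℂ)) ^ 2 * τ +
      2 * Real.pi * Complex.I * ((m : ℂ) + (a : ℂ)) * (z + b))‖ := by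
  have h := (((summable_jacobiTheta₂_term_iff (a * τ + z + b) τ).2 hτ).mul_left
    (Complex.exp (Real.pi * Complex.I * a ^ 2 * τ + 2 * Real.pi * Complex.I * a * (z + b)))).norm
  refine h.congr fun m => ?_
  rw [jacobiTheta₂_term, ← Complex.exp_add]
  congr 2
  ring

/-- Finite products of absolutely convergent series are absolutely convergent multiple series. -/
theorem summable_norm_pi_prod_and_prod_tsum {ι R : Type*} [NormedCommRing R] [NormOneClass R]
    [CompleteSpace R] (d : ℕ) (f : Fin d → ι → R) (hf : ∀ i, Summable fun m => ‖f i m‖) :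
    (Summable fun m : Fin d → ι => ‖∏ i, f i (m i)‖) ∧
      ∏ i, ∑' m, f i m = ∑' m : Fin d → ι, ∏ i, f i (m i) := by
  induction d with
  | zero => exact ⟨(hasSum_fintype _).summable, by simp⟩
  | succ d ih =>
    obtain ⟨hs, ht⟩ := ih (fun i => f i.succ) fun i => hf i.succ
    constructor
    · rw [← (Fin.consEquiv fun _ : Fin (d + 1) => ι).summable_iff]
      refine ((hf 0).mul_norm hs).congr fun x => ?_
      simp [Fin.consEquiv, Fin.prod_univ_succ]
    · rw [Fin.prod_univ_succ, ht, tsum_mul_tsum_of_summable_norm (hf 0) hs,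
        ← (Fin.consEquiv fun _ : Fin (d + 1) => ι).tsum_eq]
      simp [Fin.consEquiv, Fin.prod_univ_succ]

/-- Completing the square: `Σ nᵢ(k+pᵢ)² = 2 S_d(p) + n_{0,d}(k+p_{0,d})²`. -/
theorem sum_mul_add_sq_eq_Sform (d : ℕ) (n : ℕ → ℤ) (p : ℕ → ℝ) (k : ℝ)
    (hN : ∑ i ∈ Finset.range d, (n i : ℝ) ≠ 0) :
    ∑ i ∈ Finset.range d, (n i : ℝ) * (k + p i) ^ 2 =
      2 * Sform d n p + (∑ i ∈ Finset.range d, (n i : ℝ)) *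
        (k + (∑ i ∈ Finset.range d, (n i : ℝ) * p i) / ∑ i ∈ Finset.range d, (n i : ℝ)) ^ 2 := by
  have h₁ : ∑ i ∈ Finset.range d, (n i : ℝ) * (k + p i) ^ 2 =
      (∑ i ∈ Finset.range d, (n i : ℝ)) * k ^ 2 +
        2 * k * (∑ i ∈ Finset.range d, (n i : ℝ) * p i) +
        ∑ i ∈ Finset.range d, (n i : ℝ) * p i ^ 2 := by
    rw [Finset.sum_mul, Finset.mul_sum, ← Finset.sum_add_distrib, ← Finset.sum_add_distrib]
    exact Finset.sum_congr rfl fun i _ => by ring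
  have h₂ : ∑ i ∈ Finset.range d, (n i : ℝ) * p i * (p i - 1) =
      (∑ i ∈ Finset.range d, (n i : ℝ) * p i ^ 2) - ∑ i ∈ Finset.range d, (n i : ℝ) * p i := by
    rw [← Finset.sum_sub_distrib]
    exact Finset.sum_congr rfl fun i _ => by ring
  rw [Sform, h₁, h₂]
  field_simp
  ring

/-- The product of theta terms with characteristics `pᵢ` at a common index is `exp(2πiτ S_d(p))`
times the theta term with characteristic `p_{0,d}`. -/
theorem prod_theta_term_eq (d : ℕ) (n : ℕ → ℤ) (p : ℕ → ℝ) (k : ℤ) (z τ : ℂ)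
    (hN : ∑ i ∈ Finset.range d, (n i : ℝ) ≠ 0) :
    ∏ i ∈ Finset.range d, Complex.exp
        (Real.pi * Complex.I * ((k : ℂ) + (p i : ℂ)) ^ 2 * ((n i : ℂ) * τ) +
          2 * Real.pi * Complex.I * ((k : ℂ) + (p i : ℂ)) * ((n i : ℂ) * z + 0)) =
      Complex.exp (2 * (Real.pi : ℂ) * Complex.I * τ * ((Sform d n p : ℝ) : ℂ)) *
        Complex.exp (Real.pi * Complex.I * ((k : ℂ) + (((∑ i ∈ Finset.range d, (n i : ℝ) * p i) /
            ((∑ i ∈ Finset.range d, n i : ℤ) : ℝ) : ℝ) : ℂ)) ^ 2 *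
            (((∑ i ∈ Finset.range d, n i : ℤ) : ℂ) * τ) +
          2 * Real.pi * Complex.I * ((k : ℂ) + (((∑ i ∈ Finset.range d, (n i : ℝ) * p i) /
            ((∑ i ∈ Finset.range d, n i : ℤ) : ℝ) : ℝ) : ℂ)) *
            (((∑ i ∈ Finset.range d, n i : ℤ) : ℂ) * z + 0)) := by
  have hquad := congrArg (Complex.ofReal) (sum_mul_add_sq_eq_Sform d n p k hN)
  have hlin : ∑ i ∈ Finset.range d, (n i : ℝ) * (k + p i) =
      (∑ i ∈ Finset.range d, (n i : ℝ)) *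
        (k + (∑ i ∈ Finset.range d, (n i : ℝ) * p i) / ∑ i ∈ Finset.range d, (n i : ℝ)) := by
    rw [mul_add, mul_div_cancel₀ _ hN, Finset.sum_mul, ← Finset.sum_add_distrib]
    exact Finset.sum_congr rfl fun i _ => by ring
  replace hlin := congrArg (Complex.ofReal) hlin
  have hsum : ∑ i ∈ Finset.range d,
        (Real.pi * Complex.I * ((k : ℂ) + (p i : ℂ)) ^ 2 * ((n i : ℂ) * τ) +
          2 * Real.pi * Complex.I * ((k : ℂ) + (p i : ℂ)) * ((n i : ℂ) * z + 0)) =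
      Real.pi * Complex.I * τ * (∑ i ∈ Finset.range d, (n i : ℂ) * ((k : ℂ) + (p i : ℂ)) ^ 2) +
        2 * Real.pi * Complex.I * z *
          (∑ i ∈ Finset.range d, (n i : ℂ) * ((k : ℂ) + (p i : ℂ))) := by
    rw [Finset.mul_sum, Finset.mul_sum, ← Finset.sum_add_distrib]
    exact Finset.sum_congr rfl fun i _ => by ring
  rw [← Complex.exp_sum, ← Complex.exp_add, hsum]
  congr 1
  push_cast at hquad hlin ⊢
  rw [hquad, hlin]
  ring

/-- The change of summation indices `(α, k) ↦ (k, k - α₁, …, k - α_e)`. -/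
def shiftEquiv (e : ℕ) : (Fin e → ℤ) × ℤ ≃ (Fin (e + 1) → ℤ) where
  toFun x := Fin.cons x.2 fun j => x.2 - x.1 j
  invFun m := (fun j => m 0 - m j.succ, m 0)
  left_inv x := by simp
  right_inv m := by
    funext i
    refine Fin.cases ?_ (fun j => ?_) i <;> simp

theorem shiftEquiv_add_char (e : ℕ) (n : ℕ → ℤ) (hn : ∀ i < e + 1, n i ≠ 0) (a : ℕ → ℝ)
    (x : (Fin e → ℤ) × ℤ) (i : Fin (e + 1)) :
    (shiftEquiv e x i : ℝ) + a i / (n i : ℝ) =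
      x.2 + shiftedChar (e + 1) n a x.1 i / (n i : ℝ) := by
  have hni : (n i : ℝ) ≠ 0 := by exact_mod_cast hn i i.2
  induction i using Fin.cases with
  | zero => simp [shiftEquiv, shiftedChar]
  | succ j =>
    have h : 1 ≤ (j.succ : ℕ) ∧ (j.succ : ℕ) < e + 1 := ⟨by simp, j.succ.2⟩
    rw [shiftedChar, dif_pos h]
    have hj : (⟨(j.succ : ℕ) - 1, by omega⟩ : Fin (e + 1 - 1)) = j := Fin.ext (by simp)
    rw [hj]
    simp only [shiftEquiv, Equiv.coe_fn_mk, Fin.cons_succ]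
    push_cast
    field_simp
    ring

/-- Integers `nᵢ` with all `Im(nᵢτ) > 0` have nonzero sum. -/
theorem sum_ne_zero_of_im_pos (d : ℕ) (hd : d ≠ 0) (n : ℕ → ℤ) (τ : ℂ)
    (hτ : ∀ i < d, 0 < ((n i : ℂ) * τ).im) : ∑ i ∈ Finset.range d, (n i : ℝ) ≠ 0 := by
  intro h
  have hpos : 0 < ∑ i ∈ Finset.range d, (n i : ℝ) * τ.im := by
    refine Finset.sum_pos (fun i hi => ?_) (by simpa using hd)
    simpa using hτ i (Finset.mem_range.1 hi)
  rw [← Finset.sum_mul, h, zero_mul] at hpos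
  exact hpos.false

/-- A product of absolutely convergent series over `ℤ`, summed along diagonals. -/
theorem prod_tsum_eq_tsum_shiftEquiv (e : ℕ) (f : Fin (e + 1) → ℤ → ℂ)
    (hf : ∀ i, Summable fun m => ‖f i m‖) :
    ∏ i, ∑' m, f i m = ∑' (α : Fin e → ℤ) (k : ℤ), ∏ i, f i (shiftEquiv e (α, k) i) := by
  obtain ⟨hs, ht⟩ := summable_norm_pi_prod_and_prod_tsum (e + 1) f hf
  have hshift : Summable ((fun m : Fin (e + 1) → ℤ => ∏ i, f i (m i)) ∘ shiftEquiv e) :=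
    (shiftEquiv e).summable_iff.2 (Summable.of_norm hs)
  rw [ht, ← (shiftEquiv e).tsum_eq fun m => ∏ i, f i (m i)]
  exact hshift.tsum_prod

/-- After the change of indices, a term of the multiple series for the product factors into
`exp(2πiτ S_d)` and a term of the theta series on the right-hand side. -/
theorem prod_theta_term_shiftEquiv (e : ℕ) (n : ℕ → ℤ) (hn : ∀ i < e + 1, n i ≠ 0) (a : ℕ → ℝ)
    (z τ : ℂ) (hN : ∑ i ∈ Finset.range (e + 1), (n i : ℝ) ≠ 0) (α : Fin e → ℤ) (k : ℤ) :
    ∏ i : Fin (e + 1), Complex.exp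
        (Real.pi * Complex.I * ((shiftEquiv e (α, k) i : ℂ) + ((a i / (n i : ℝ) : ℝ) : ℂ)) ^ 2 *
            ((n i : ℂ) * τ) +
          2 * Real.pi * Complex.I * ((shiftEquiv e (α, k) i : ℂ) + ((a i / (n i : ℝ) : ℝ) : ℂ)) *
            ((n i : ℂ) * z + 0)) =
      Complex.exp (2 * (Real.pi : ℂ) * Complex.I * τ *
          ((Sform (e + 1) n (fun i => shiftedChar (e + 1) n a α i / (n i : ℝ)) : ℝ) : ℂ)) *
        Complex.exp (Real.pi * Complex.I * ((k : ℂ) +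
            (((∑ i ∈ Finset.range (e + 1), shiftedChar (e + 1) n a α i) /
              ((∑ i ∈ Finset.range (e + 1), n i : ℤ) : ℝ) : ℝ) : ℂ)) ^ 2 *
            (((∑ i ∈ Finset.range (e + 1), n i : ℤ) : ℂ) * τ) +
          2 * Real.pi * Complex.I * ((k : ℂ) +
            (((∑ i ∈ Finset.range (e + 1), shiftedChar (e + 1) n a α i) /
              ((∑ i ∈ Finset.range (e + 1), n i : ℤ) : ℝ) : ℝ) : ℂ)) *
            (((∑ i ∈ Finset.range (e + 1), n i : ℤ) : ℂ) * z + 0)) := by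
  have hsum : ∑ i ∈ Finset.range (e + 1), shiftedChar (e + 1) n a α i =
      ∑ i ∈ Finset.range (e + 1), (n i : ℝ) * (shiftedChar (e + 1) n a α i / (n i : ℝ)) := by
    refine Finset.sum_congr rfl fun i hi => ?_
    have hni : (n i : ℝ) ≠ 0 := by exact_mod_cast hn i (Finset.mem_range.1 hi)
    rw [mul_div_cancel₀ _ hni]
  have h := prod_theta_term_eq (e + 1) n
    (fun i => shiftedChar (e + 1) n a α i / (n i : ℝ)) k z τ hN
  rw [hsum, ← h, Finset.prod_range]
  refine Finset.prod_congr rfl fun i _ => ?_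
  have hx := congrArg Complex.ofReal (shiftEquiv_add_char e n hn a (α, k) i)
  rw [Complex.ofReal_add, Complex.ofReal_add, Complex.ofReal_intCast,
    Complex.ofReal_intCast] at hx
  rw [hx]

/-- d-fold product formula for theta functions:
`θ_{n₀₁}[a₀₁/n₀₁](z,τ) ⋯ θ_{n_{d−1,d}}[a_{d−1,d}/n_{d−1,d}](z,τ)
  = Σ_{α ∈ ℤ^{d−1}} exp(2πiτ S_d(ã₀₁/n₀₁,…,ã_{d−1,d}/n_{d−1,d}))
      θ_{n_{0,d}}[(ã₀₁+⋯+ã_{d−1,d})/n_{0,d}](z,τ)`. -/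
theorem thetaN_d_fold_product (d : ℕ) (hd : 2 ≤ d) (n : ℕ → ℤ) (hn : ∀ i < d, n i ≠ 0)
    (a : ℕ → ℝ) (z τ : ℂ) (hτ : ∀ i < d, 0 < ((n i : ℂ) * τ).im) :
    ∏ i ∈ Finset.range d, thetaN (n i) (a i / (n i : ℝ)) z τ =
      ∑' α : Fin (d - 1) → ℤ,
        Complex.exp (2 * (Real.pi : ℂ) * Complex.I * τ *
            ((Sform d n (fun i => shiftedChar d n a α i / (n i : ℝ)) : ℝ) : ℂ)) *
        thetaN (∑ i ∈ Finset.range d, n i)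
          ((∑ i ∈ Finset.range d, shiftedChar d n a α i) /
            ((∑ i ∈ Finset.range d, n i : ℤ) : ℝ)) z τ := by
  obtain ⟨e, rfl⟩ : ∃ e, d = e + 1 := ⟨d - 1, by omega⟩
  have hN := sum_ne_zero_of_im_pos (e + 1) (by omega) n τ hτ
  rw [Finset.prod_range]
  simp only [thetaN, theta]
  rw [prod_tsum_eq_tsum_shiftEquiv e _ fun i =>
    summable_norm_theta_term (a i / (n i : ℝ)) 0 ((n i : ℂ) * z) ((n i : ℂ) * τ) (hτ i i.2)]
  refine tsum_congr fun α => ?_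
  rw [← tsum_mul_left]
  exact tsum_congr fun k => prod_theta_term_shiftEquiv e n hn a z τ hN α k
end
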